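/- arXiv:math/0312136 — 2 statements merged into one kernel-verified Lean document; each statement's English description precedes it below -/
import Mathlib

section
/- For every cellular automaton F on a closed σ-invariant set X ⊆ A^ℤ, every x ∈ X and all positive integers n, m, one has Λ̃⁺_{n+m}(x) ≤ Λ̃ₙ⁺(x) + Λ̃ₘ⁺(σ^{Λ̃ₙ⁺(x)}(F^n(x))); consequently, for any F-invariant closed σ-invariant set Y ⊆ X, the sequence (max_{y ∈ Y} Λ̃ₙ⁺(y))_{n∈ℕ} is subadditive. -/
open MeasureTheory Filter Topology Set

noncomputable section

/-- The shift map `σ` on `ℤ → A`, defined by `(σ x) i = x (i + 1)`. -/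
def shiftMap (A : Type*) : (ℤ → A) → (ℤ → A) := fun x i => x (i + 1)

/-- The iterate `σ^j` of the shift, for `j : ℤ`: `(σ^j x) i = x (i + j)`. -/
def shiftIter {A : Type*} (j : ℤ) (x : ℤ → A) : ℤ → A := fun i => x (i + j)

/-- `F` admits a local rule of radius `r`:
`F(x)_i = f (x_{i-r}, …, x_{i+r})` for a block map `f : A^{2r+1} → A`. -/
def HasLocalRule {A : Type*} (F : (ℤ → A) → (ℤ → A)) (r : ℕ) : Prop :=
  ∃ f : (Fin (2 * r + 1) → A) → A, ∀ (x : ℤ → A) (i : ℤ),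
    F x i = f fun j => x (i - (r : ℤ) + ((j : ℕ) : ℤ))

/-- `W_s⁺(x) = {y ∈ X : y_i = x_i for all i ≥ s}`. -/
def Wplus {A : Type*} (X : Set (ℤ → A)) (s : ℤ) (x : ℤ → A) : Set (ℤ → A) :=
  {y ∈ X | ∀ i : ℤ, s ≤ i → y i = x i}

/-- `W_s⁻(x) = {y ∈ X : y_i = x_i for all i ≤ s}`. -/
def Wminus {A : Type*} (X : Set (ℤ → A)) (s : ℤ) (x : ℤ → A) : Set (ℤ → A) :=
  {y ∈ X | ∀ i : ℤ, i ≤ s → y i = x i}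

/-- `Λ̃ₙ⁺(x) = min{s ≥ 0 : F^i(W₀⁺(x)) ⊆ W_s⁺(F^i(x)) for all 1 ≤ i ≤ n}`. -/
def lamTildeP {A : Type*} (X : Set (ℤ → A)) (F : (ℤ → A) → (ℤ → A)) (n : ℕ)
    (x : ℤ → A) : ℕ :=
  sInf {s : ℕ | ∀ i : ℕ, 1 ≤ i → i ≤ n →
    F^[i] '' Wplus X 0 x ⊆ Wplus X (s : ℤ) (F^[i] x)}

/-- `Λ̃ₙ⁻(x) = min{s ≥ 0 : F^i(W₀⁻(x)) ⊆ W_{-s}⁻(F^i(x)) for all 1 ≤ i ≤ n}`. -/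
def lamTildeM {A : Type*} (X : Set (ℤ → A)) (F : (ℤ → A) → (ℤ → A)) (n : ℕ)
    (x : ℤ → A) : ℕ :=
  sInf {s : ℕ | ∀ i : ℕ, 1 ≤ i → i ≤ n →
    F^[i] '' Wminus X 0 x ⊆ Wminus X (-(s : ℤ)) (F^[i] x)}

/-- `Λₙ⁺(x) = max_{j ∈ ℤ} Λ̃ₙ⁺(σ^j x)`. -/
def lamP {A : Type*} (X : Set (ℤ → A)) (F : (ℤ → A) → (ℤ → A)) (n : ℕ)
    (x : ℤ → A) : ℕ :=
  sSup (Set.range fun j : ℤ => lamTildeP X F n (shiftIter j x))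

/-- `Λₙ⁻(x) = max_{j ∈ ℤ} Λ̃ₙ⁻(σ^j x)`. -/
def lamM {A : Type*} (X : Set (ℤ → A)) (F : (ℤ → A) → (ℤ → A)) (n : ℕ)
    (x : ℤ → A) : ℕ :=
  sSup (Set.range fun j : ℤ => lamTildeM X F n (shiftIter j x))

/-- `Iₙ⁺(x) = min{s ≥ 0 : F^i(W_{-s}⁺(x)) ⊆ W₀⁺(F^i(x)) for all 1 ≤ i ≤ n}`. -/
def Iplus {A : Type*} (X : Set (ℤ → A)) (F : (ℤ → A) → (ℤ → A)) (n : ℕ)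
    (x : ℤ → A) : ℕ :=
  sInf {s : ℕ | ∀ i : ℕ, 1 ≤ i → i ≤ n →
    F^[i] '' Wplus X (-(s : ℤ)) x ⊆ Wplus X 0 (F^[i] x)}

/-- `Iₙ⁻(x) = min{s ≥ 0 : F^i(W_s⁻(x)) ⊆ W₀⁻(F^i(x)) for all 1 ≤ i ≤ n}`. -/
def Iminus {A : Type*} (X : Set (ℤ → A)) (F : (ℤ → A) → (ℤ → A)) (n : ℕ)
    (x : ℤ → A) : ℕ :=
  sInf {s : ℕ | ∀ i : ℕ, 1 ≤ i → i ≤ n →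
    F^[i] '' Wminus X (s : ℤ) x ⊆ Wminus X 0 (F^[i] x)}

/-- Average Lyapunov exponent `I_μ⁺ = liminf_n (∫ Iₙ⁺ dμ) / n`. -/
def avgIplus {A : Type*} [MeasurableSpace A] (X : Set (ℤ → A))
    (F : (ℤ → A) → (ℤ → A)) (μ : Measure (ℤ → A)) : ℝ :=
  Filter.liminf (fun n : ℕ => (∫ x, (Iplus X F n x : ℝ) ∂μ) / n) Filter.atTop

/-- Average Lyapunov exponent `I_μ⁻ = liminf_n (∫ Iₙ⁻ dμ) / n`. -/
def avgIminus {A : Type*} [MeasurableSpace A] (X : Set (ℤ → A))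
    (F : (ℤ → A) → (ℤ → A)) (μ : Measure (ℤ → A)) : ℝ :=
  Filter.liminf (fun n : ℕ => (∫ x, (Iminus X F n x : ℝ) ∂μ) / n) Filter.atTop

/-- The topological support `S(μ)` of a measure `μ` on `ℤ → A`. -/
def msupp {A : Type*} [TopologicalSpace A] [MeasurableSpace A]
    (μ : Measure (ℤ → A)) : Set (ℤ → A) :=
  {x | ∀ U : Set (ℤ → A), IsOpen U → x ∈ U → 0 < μ U}

/-- `x` is an equicontinuous point of `F` on `X`: for every `ε = 2^{-m}` there is a
`δ = 2^{-k}` such that points of `X` agreeing with `x` on coordinates `|j| ≤ k`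
have all their `F`-iterates agreeing with those of `x` on coordinates `|j| ≤ m`. -/
def IsEquicontPt {A : Type*} (X : Set (ℤ → A)) (F : (ℤ → A) → (ℤ → A))
    (x : ℤ → A) : Prop :=
  ∀ m : ℕ, ∃ k : ℕ, ∀ y ∈ X, (∀ j : ℤ, |j| ≤ (k : ℤ) → y j = x j) →
    ∀ n : ℕ, ∀ j : ℤ, |j| ≤ (m : ℤ) → F^[n] y j = F^[n] x j

/-- Entropy `H_μ(α) = ∑ -μ(A) log μ(A)` of the finite partition given by the
fibers of `α`. -/
def partEnt {Ω : Type*} [MeasurableSpace Ω] (μ : Measure Ω) {I : Type*} [Fintype I]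
    (α : Ω → I) : ℝ :=
  ∑ i : I, Real.negMulLog (μ (α ⁻¹' {i})).toReal

/-- Metric entropy `h_μ(T, α)` of `T` relative to the finite partition `α`
(the limit of the subadditive sequence `H_μ(α ∨ T⁻¹α ∨ … ∨ T^{-n}α)/(n+1)`
equals its infimum). -/
def entropyPart {Ω : Type*} [MeasurableSpace Ω] (μ : Measure Ω) (T : Ω → Ω)
    {k : ℕ} (α : Ω → Fin k) : ℝ :=
  ⨅ n : ℕ, partEnt μ (fun x (i : Fin (n + 1)) => α (T^[(i : ℕ)] x)) / (n + 1)

/-- Kolmogorov–Sinai metric entropy `h_μ(T)`: supremum of `h_μ(T, α)` over all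
finite measurable partitions `α`. -/
def metricEntropy {Ω : Type*} [MeasurableSpace Ω] (μ : Measure Ω) (T : Ω → Ω) : ℝ :=
  ⨆ p : {q : Σ k : ℕ, Ω → Fin k // Measurable q.2}, entropyPart μ T p.1.2

/-- `B ∈ A^{2k+1}` is a blocking word for `F` (with radius `r`): there are `i` with
`2i+1 ≥ r` and words `vₙ ∈ A^{2i+1}`, independent of `x`, such that every `x ∈ X`
with `x(-k,k) = B` satisfies `F^n(x)(-i,i) = vₙ` for all `n ≥ 1`. -/
def IsBlockingWord {A : Type*} (X : Set (ℤ → A)) (F : (ℤ → A) → (ℤ → A)) (r k : ℕ)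
    (B : Fin (2 * k + 1) → A) : Prop :=
  ∃ i : ℕ, r ≤ 2 * i + 1 ∧ ∃ v : ℕ → Fin (2 * i + 1) → A,
    ∀ x ∈ X, (∀ j : Fin (2 * k + 1), x (((j : ℕ) : ℤ) - (k : ℤ)) = B j) →
      ∀ n : ℕ, 1 ≤ n → ∀ j : Fin (2 * i + 1),
        F^[n] x (((j : ℕ) : ℤ) - (i : ℤ)) = v n j

/-- `D(n, 2^{-p})`: minimal cardinality of an `(n, 2^{-p})`-covering (spanning) set
for `F`, where closeness in the Bowen metric `d_n` up to `2^{-p}` means agreement of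
all iterates `F^i`, `i ≤ n`, on the coordinates `|j| ≤ p`. -/
def coverNum {A : Type*} (F : (ℤ → A) → (ℤ → A)) (n p : ℕ) : ℕ :=
  sInf {N : ℕ | ∃ S : Finset (ℤ → A), S.card ≤ N ∧ ∀ x : ℤ → A, ∃ y ∈ S,
    ∀ i : ℕ, i ≤ n → ∀ j : ℤ, |j| ≤ (p : ℤ) → F^[i] x j = F^[i] y j}

/-- Topological entropy `h_top(F) = lim_{ε→0} lim_n (1/n) log D(n, ε)`. -/
def htop {A : Type*} (F : (ℤ → A) → (ℤ → A)) : ℝ :=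
  ⨆ p : ℕ, Filter.limsup (fun n : ℕ => Real.log (coverNum F n p) / n) Filter.atTop

end

theorem HasLocalRule.eqOn_Ici {A : Type*} {F : (ℤ → A) → (ℤ → A)} {r : ℕ}
    (hF : HasLocalRule F r) {x y : ℤ → A} {s : ℤ} (h : ∀ i, s ≤ i → y i = x i) :
    ∀ i, s + r ≤ i → F y i = F x i := by
  obtain ⟨f, hf⟩ := hF
  intro i hi
  rw [hf, hf]
  congr 1
  funext j
  exact h _ (by omega)

theorem HasLocalRule.iterate_eqOn_Ici {A : Type*} {F : (ℤ → A) → (ℤ → A)} {r : ℕ}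
    (hF : HasLocalRule F r) {x y : ℤ → A} {s : ℤ} (h : ∀ i, s ≤ i → y i = x i) (n : ℕ) :
    ∀ i, s + (n * r : ℕ) ≤ i → F^[n] y i = F^[n] x i := by
  induction n with
  | zero => simpa using h
  | succ n ih =>
    intro i hi
    rw [Function.iterate_succ_apply', Function.iterate_succ_apply']
    refine hF.eqOn_Ici ih i ?_
    rw [Nat.succ_mul] at hi
    push_cast at hi ⊢
    linarith

theorem HasLocalRule.commute_shiftIter {A : Type*} {F : (ℤ → A) → (ℤ → A)} {r : ℕ}
    (hF : HasLocalRule F r) (j : ℤ) : Function.Commute F (shiftIter j) := by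
  obtain ⟨f, hf⟩ := hF
  intro x
  funext i
  simp only [shiftIter, hf]
  congr 1
  funext k
  congr 1
  ring

theorem shiftIter_natCast_mem {A : Type*} {X : Set (ℤ → A)} (hX : shiftMap A '' X = X)
    {x : ℤ → A} (hx : x ∈ X) (n : ℕ) : shiftIter (n : ℤ) x ∈ X := by
  induction n with
  | zero => simpa [show shiftIter (0 : ℤ) x = x from funext fun i => by simp [shiftIter]] using hx
  | succ n ih =>
    rw [← hX]
    refine ⟨_, ih, ?_⟩
    funext i
    simp only [shiftMap, shiftIter]
    congr 1
    push_cast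
    ring

theorem mul_mem_lamTildeP_set {A : Type*} {X : Set (ℤ → A)} {F : (ℤ → A) → (ℤ → A)} {r : ℕ}
    (hFX : Set.MapsTo F X X) (hF : HasLocalRule F r) (n : ℕ) (x : ℤ → A) :
    n * r ∈ {s : ℕ | ∀ i : ℕ, 1 ≤ i → i ≤ n →
      F^[i] '' Wplus X 0 x ⊆ Wplus X (s : ℤ) (F^[i] x)} := by
  rintro i - hin _ ⟨y, ⟨hyX, hy⟩, rfl⟩
  refine ⟨hFX.iterate i hyX, fun k hk => hF.iterate_eqOn_Ici hy i k ?_⟩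
  have : i * r ≤ n * r := Nat.mul_le_mul_right r hin
  omega

theorem lamTildeP_le_mul {A : Type*} {X : Set (ℤ → A)} {F : (ℤ → A) → (ℤ → A)} {r : ℕ}
    (hFX : Set.MapsTo F X X) (hF : HasLocalRule F r) (n : ℕ) (x : ℤ → A) :
    lamTildeP X F n x ≤ n * r :=
  Nat.sInf_le (mul_mem_lamTildeP_set hFX hF n x)

theorem image_Wplus_subset_lamTildeP {A : Type*} {X : Set (ℤ → A)} {F : (ℤ → A) → (ℤ → A)}
    {r : ℕ} (hFX : Set.MapsTo F X X) (hF : HasLocalRule F r) {n i : ℕ} (x : ℤ → A)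
    (hi : 1 ≤ i) (hin : i ≤ n) :
    F^[i] '' Wplus X 0 x ⊆ Wplus X (lamTildeP X F n x : ℤ) (F^[i] x) :=
  Nat.sInf_mem ⟨_, mul_mem_lamTildeP_set hFX hF n x⟩ i hi hin

theorem lamTildeP_add_le {A : Type*} {X : Set (ℤ → A)} {F : (ℤ → A) → (ℤ → A)} {r : ℕ}
    (hXσ : shiftMap A '' X = X) (hFX : Set.MapsTo F X X) (hF : HasLocalRule F r)
    (x : ℤ → A) {n : ℕ} (hn : 1 ≤ n) (m : ℕ) :
    lamTildeP X F (n + m) x ≤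
      lamTildeP X F n x +
        lamTildeP X F m (shiftIter ((lamTildeP X F n x : ℕ) : ℤ) (F^[n] x)) := by
  set a := lamTildeP X F n x with ha
  refine Nat.sInf_le ?_
  rintro i hi hinm _ ⟨y, hy, rfl⟩
  refine ⟨hFX.iterate i hy.1, fun k hk => ?_⟩
  push_cast at hk
  rcases le_or_gt i n with hin | hin
  · exact (image_Wplus_subset_lamTildeP hFX hF x hi hin ⟨y, hy, rfl⟩).2 k (by omega)
  · obtain ⟨l, rfl⟩ := Nat.exists_eq_add_of_lt hin
    have hyn := image_Wplus_subset_lamTildeP hFX hF x hn le_rfl ⟨y, hy, rfl⟩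
    have hmem : shiftIter (a : ℤ) (F^[n] y) ∈ Wplus X 0 (shiftIter (a : ℤ) (F^[n] x)) :=
      ⟨shiftIter_natCast_mem hXσ hyn.1 a, fun j hj => hyn.2 (j + a) (by omega)⟩
    have key := (image_Wplus_subset_lamTildeP (n := m) (i := l + 1) hFX hF _ (by omega)
      (by omega) ⟨_, hmem, rfl⟩).2 (k - a) (by omega)
    have hcomm := (hF.commute_shiftIter (a : ℤ)).iterate_left (l + 1)
    rw [hcomm.eq, hcomm.eq] at key
    simp only [shiftIter, sub_add_cancel, ← Function.iterate_add_apply] at key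
    rwa [show l + 1 + n = n + l + 1 by omega] at key

/-- Subadditivity relation `Λ̃⁺_{n+m}(x) ≤ Λ̃ₙ⁺(x) + Λ̃ₘ⁺(σ^{Λ̃ₙ⁺(x)}(Fⁿ(x)))`, and
subadditivity of the sequence `(max_{y ∈ Y} Λ̃ₙ⁺(y))ₙ` for `F`-invariant subshifts
`Y ⊆ X`. -/
theorem stmt1 {A : Type*} [Fintype A] [TopologicalSpace A] [DiscreteTopology A]
    (X : Set (ℤ → A)) (hXcl : IsClosed X) (hXσ : shiftMap A '' X = X)
    (F : (ℤ → A) → (ℤ → A)) (hFX : Set.MapsTo F X X) (hFc : Continuous F)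
    (hFσ : ∀ x, F (shiftMap A x) = shiftMap A (F x))
    (r : ℕ) (hr : 1 ≤ r) (hloc : HasLocalRule F r) :
    (∀ x ∈ X, ∀ n m : ℕ, 1 ≤ n → 1 ≤ m →
      lamTildeP X F (n + m) x ≤
        lamTildeP X F n x +
          lamTildeP X F m (shiftIter ((lamTildeP X F n x : ℕ) : ℤ) (F^[n] x))) ∧
    ∀ Y : Set (ℤ → A), Y ⊆ X → IsClosed Y → shiftMap A '' Y = Y → F '' Y ⊆ Y →
      ∀ n m : ℕ, 1 ≤ n → 1 ≤ m →
        sSup (lamTildeP X F (n + m) '' Y) ≤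
          sSup (lamTildeP X F n '' Y) + sSup (lamTildeP X F m '' Y) := by
  refine ⟨fun x _ n m hn _ => lamTildeP_add_le hXσ hFX hloc x hn m, ?_⟩
  intro Y _ _ hYσ hFY n m hn _
  have hbdd (k : ℕ) : BddAbove (lamTildeP X F k '' Y) :=
    ⟨k * r, by rintro _ ⟨y, -, rfl⟩; exact lamTildeP_le_mul hFX hloc k y⟩
  refine csSup_le' ?_
  rintro _ ⟨y, hy, rfl⟩
  have hmem := shiftIter_natCast_mem hYσ ((Set.mapsTo_iff_image_subset.mpr hFY).iterate n hy)
    (lamTildeP X F n y)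
  exact (lamTildeP_add_le hXσ hFX hloc y hn m).trans
    (add_le_add (le_csSup (hbdd n) ⟨y, hy, rfl⟩) (le_csSup (hbdd m) ⟨_, hmem, rfl⟩))
end

section
/- Let F be a cellular automaton with radius r on a closed σ-invariant set X ⊆ A^ℤ and μ a σ-ergodic Borel probability measure. If there exists an equicontinuous point of F in the topological support S(μ), then for every integer p ≥ r and μ-almost every x, the sequence ( Iₙ⁺(σ^{-p}(x)) + Iₙ⁻(σ^{p}(x)) )_{n∈ℕ} is bounded. -/
open MeasureTheory Filter Topology Set

section ShiftAndLocalRule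

variable {A : Type*} {F : (ℤ → A) → (ℤ → A)} {r : ℕ}

lemma shiftMap_iterate (n : ℕ) (x : ℤ → A) : (shiftMap A)^[n] x = shiftIter (n : ℤ) x := by
  induction n with
  | zero => funext i; simp [shiftIter]
  | succ n ih =>
    rw [Function.iterate_succ_apply', ih]
    funext i
    simp only [shiftMap, shiftIter]
    congr 1
    push_cast
    ring

lemma shiftIter_shiftIter (a b : ℤ) (x : ℤ → A) :
    shiftIter a (shiftIter b x) = shiftIter (a + b) x := by
  funext i
  simp only [shiftIter, add_assoc]

lemma shiftIter_shiftMap (a : ℤ) (x : ℤ → A) :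
    shiftIter a (shiftMap A x) = shiftIter (a + 1) x := by
  funext i
  simp only [shiftIter, shiftMap, add_assoc]

lemma shiftIter_zero (x : ℤ → A) : shiftIter 0 x = x := by
  funext i
  simp [shiftIter]

lemma shiftIter_mem {X : Set (ℤ → A)} (hX : shiftMap A '' X = X) (j : ℤ) {x : ℤ → A}
    (hx : x ∈ X) : shiftIter j x ∈ X := by
  induction j with
  | zero => rwa [shiftIter_zero]
  | succ n ih =>
    rw [← hX]
    refine ⟨_, ih, ?_⟩
    funext i
    simp only [shiftIter, shiftMap]
    congr 1
    ring
  | pred n ih =>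
    rw [← hX] at ih
    obtain ⟨y, hy, hyx⟩ := ih
    convert hy using 1
    funext i
    have := congrFun hyx (i - 1)
    simp only [shiftIter, shiftMap, sub_add_cancel] at this ⊢
    rw [this]
    congr 1
    ring

lemma HasLocalRule.congr (h : HasLocalRule F r) {y z : ℤ → A} {c : ℤ}
    (hyz : ∀ j, c - r ≤ j → j ≤ c + r → y j = z j) : F y c = F z c := by
  obtain ⟨f, hf⟩ := h
  rw [hf, hf]
  congr 1
  funext j
  have := j.isLt
  exact hyz _ (by omega) (by omega)

lemma HasLocalRule.iterate_shiftIter (h : HasLocalRule F r) (n : ℕ) (j : ℤ) (x : ℤ → A) :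
    F^[n] (shiftIter j x) = shiftIter j (F^[n] x) := by
  obtain ⟨f, hf⟩ := h
  have hcomm : Function.Commute F (shiftIter j) := fun x => by
    funext i
    simp only [shiftIter, hf]
    congr 1
    funext k
    congr 1
    ring
  exact hcomm.iterate_left n x

/-- Agreement to the right propagates in time if the left boundary strip of width `2r+1`
never distinguishes the two points. -/
lemma HasLocalRule.eq_right_of_strip (h : HasLocalRule F r) {y z : ℤ → A} {c : ℤ}
    (h0 : ∀ i, c - r ≤ i → y i = z i)
    (hstrip : ∀ n : ℕ, ∀ i : ℤ, |i| ≤ r → F^[n] y (i + c) = F^[n] z (i + c)) (n : ℕ) :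
    ∀ i, c - r ≤ i → F^[n] y i = F^[n] z i := by
  induction n with
  | zero => exact h0
  | succ n ih =>
    intro i hi
    rcases le_or_gt i (c + r) with h1 | h1
    · have := hstrip (n + 1) (i - c) (abs_le.2 ⟨by omega, by omega⟩)
      rwa [sub_add_cancel] at this
    · rw [Function.iterate_succ_apply', Function.iterate_succ_apply']
      exact h.congr fun j hj _ => ih j (by omega)

/-- Agreement to the left propagates in time if the right boundary strip of width `2r+1`
never distinguishes the two points. -/
lemma HasLocalRule.eq_left_of_strip (h : HasLocalRule F r) {y z : ℤ → A} {c : ℤ}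
    (h0 : ∀ i, i ≤ c + r → y i = z i)
    (hstrip : ∀ n : ℕ, ∀ i : ℤ, |i| ≤ r → F^[n] y (i + c) = F^[n] z (i + c)) (n : ℕ) :
    ∀ i, i ≤ c + r → F^[n] y i = F^[n] z i := by
  induction n with
  | zero => exact h0
  | succ n ih =>
    intro i hi
    rcases le_or_gt (c - r) i with h1 | h1
    · have := hstrip (n + 1) (i - c) (abs_le.2 ⟨by omega, by omega⟩)
      rwa [sub_add_cancel] at this
    · rw [Function.iterate_succ_apply', Function.iterate_succ_apply']
      exact h.congr fun j _ hj => ih j (by omega)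

end ShiftAndLocalRule

/-- The cylinder of points agreeing with `x` on the coordinates `|j| ≤ k`. -/
def centralCylinder {A : Type*} (k : ℕ) (x : ℤ → A) : Set (ℤ → A) :=
  {y | ∀ j : ℤ, |j| ≤ (k : ℤ) → y j = x j}

section Cylinder

variable {A : Type*}

lemma isOpen_centralCylinder [TopologicalSpace A] [DiscreteTopology A] (k : ℕ) (x : ℤ → A) :
    IsOpen (centralCylinder k x) := by
  have : centralCylinder k x = (Set.Icc (-(k : ℤ)) k).pi fun j => {x j} := by
    ext y
    simp [centralCylinder, Set.mem_pi, abs_le]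
  rw [this]
  exact isOpen_set_pi (Set.finite_Icc _ _) fun _ _ => isOpen_discrete _

variable {X : Set (ℤ → A)} {F : (ℤ → A) → (ℤ → A)} {r k : ℕ} {x₀ : ℤ → A}

lemma iterate_eq_strip_of_mem_centralCylinder (hXσ : shiftMap A '' X = X)
    (hloc : HasLocalRule F r)
    (hk : ∀ y ∈ X, (∀ j : ℤ, |j| ≤ (k : ℤ) → y j = x₀ j) →
      ∀ n : ℕ, ∀ j : ℤ, |j| ≤ (r : ℤ) → F^[n] y j = F^[n] x₀ j)
    {y z : ℤ → A} (hy : y ∈ X) (hz : z ∈ X) {c : ℤ}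
    (hzc : shiftIter c z ∈ centralCylinder k x₀)
    (hyz : ∀ i, c - k ≤ i → i ≤ c + k → y i = z i) (n : ℕ) (i : ℤ) (hi : |i| ≤ (r : ℤ)) :
    F^[n] y (i + c) = F^[n] z (i + c) := by
  have e1 := hk _ (shiftIter_mem hXσ c hz) hzc n i hi
  have e2 := hk _ (shiftIter_mem hXσ c hy) (fun j hj => by
    rw [← hzc j hj]
    have := abs_le.1 hj
    exact hyz _ (by omega) (by omega)) n i hi
  rw [hloc.iterate_shiftIter] at e1 e2
  exact e2.trans e1.symm

lemma Iplus_le_of_mem_centralCylinder (hXσ : shiftMap A '' X = X) (hFX : Set.MapsTo F X X)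
    (hloc : HasLocalRule F r)
    (hk : ∀ y ∈ X, (∀ j : ℤ, |j| ≤ (k : ℤ) → y j = x₀ j) →
      ∀ n : ℕ, ∀ j : ℤ, |j| ≤ (r : ℤ) → F^[n] y j = F^[n] x₀ j)
    {z : ℤ → A} (hz : z ∈ X) {m : ℕ}
    (hzm : shiftIter (-(m : ℤ)) z ∈ centralCylinder k x₀) (n : ℕ) :
    Iplus X F n z ≤ m + k + r := by
  refine Nat.sInf_le ?_
  rintro i - - _ ⟨y, ⟨hy, hyz⟩, rfl⟩
  refine ⟨hFX.iterate i hy, fun j hj => ?_⟩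
  refine hloc.eq_right_of_strip (c := -(m : ℤ)) (fun l hl => hyz l (by push_cast; omega)) ?_ i j
    (by omega)
  exact iterate_eq_strip_of_mem_centralCylinder hXσ hloc hk hy hz hzm
    fun l hl _ => hyz l (by push_cast; omega)

lemma Iminus_le_of_mem_centralCylinder (hXσ : shiftMap A '' X = X) (hFX : Set.MapsTo F X X)
    (hloc : HasLocalRule F r)
    (hk : ∀ y ∈ X, (∀ j : ℤ, |j| ≤ (k : ℤ) → y j = x₀ j) →
      ∀ n : ℕ, ∀ j : ℤ, |j| ≤ (r : ℤ) → F^[n] y j = F^[n] x₀ j)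
    {z : ℤ → A} (hz : z ∈ X) {m : ℕ}
    (hzm : shiftIter (m : ℤ) z ∈ centralCylinder k x₀) (n : ℕ) :
    Iminus X F n z ≤ m + k + r := by
  refine Nat.sInf_le ?_
  rintro i - - _ ⟨y, ⟨hy, hyz⟩, rfl⟩
  refine ⟨hFX.iterate i hy, fun j hj => ?_⟩
  refine hloc.eq_left_of_strip (c := (m : ℤ)) (fun l hl => hyz l (by push_cast; omega)) ?_ i j
    (by omega)
  exact iterate_eq_strip_of_mem_centralCylinder hXσ hloc hk hy hz hzm
    fun l _ hl => hyz l (by push_cast; omega)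

end Cylinder

lemma continuous_shiftIter {A : Type*} [TopologicalSpace A] (j : ℤ) :
    Continuous (shiftIter j : (ℤ → A) → (ℤ → A)) :=
  continuous_pi fun i => continuous_apply (i + j)

lemma ae_mem_of_msupp_subset {A : Type*} [Finite A] [TopologicalSpace A] [DiscreteTopology A]
    [MeasurableSpace A] {μ : Measure (ℤ → A)} {X : Set (ℤ → A)}
    (hX : msupp μ ⊆ X) : ∀ᵐ x ∂μ, x ∈ X := by
  refine measure_null_of_locally_null _ fun x hx => ?_
  have hx' : x ∉ msupp μ := fun h => hx (hX h)
  simp only [msupp, Set.mem_ofPred_eq, not_forall, not_lt, nonpos_iff_eq_zero] at hx'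
  obtain ⟨U, hU, hxU, hμU⟩ := hx'
  exact ⟨U, mem_nhdsWithin_of_mem_nhds (hU.mem_nhds hxU), hμU⟩

section Recurrence

variable {A : Type*} [Finite A] [TopologicalSpace A] [DiscreteTopology A]
  [MeasurableSpace A] [BorelSpace A] {μ : Measure (ℤ → A)}

lemma ae_exists_shiftIter_mem_right [IsProbabilityMeasure μ] (herg : Ergodic (shiftMap A) μ)
    {E : Set (ℤ → A)} (hE : IsOpen E) (hμE : 0 < μ E) (p : ℕ) :
    ∀ᵐ x ∂μ, ∃ m : ℕ, shiftIter ((m : ℤ) + p) x ∈ E := by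
  set G : Set (ℤ → A) := ⋃ m : ℕ, shiftIter ((m : ℤ) + p) ⁻¹' E with hG
  have hGo : IsOpen G := isOpen_iUnion fun m => hE.preimage (continuous_shiftIter _)
  have hsub : shiftMap A ⁻¹' G ⊆ G := by
    intro x hx
    simp only [hG, Set.mem_preimage, Set.mem_iUnion, shiftIter_shiftMap] at hx ⊢
    obtain ⟨m, hm⟩ := hx
    refine ⟨m + 1, ?_⟩
    convert hm using 2
    push_cast
    ring
  have hpos : 0 < μ G := by
    rw [← (herg.toMeasurePreserving.iterate p).measure_preimage
      hE.measurableSet.nullMeasurableSet] at hμE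
    refine hμE.trans_le (measure_mono fun x hx => ?_)
    rw [Set.mem_preimage, shiftMap_iterate] at hx
    exact Set.mem_iUnion.2 ⟨0, by simpa using hx⟩
  rcases herg.ae_empty_or_univ_of_preimage_ae_le hGo.measurableSet.nullMeasurableSet
    (LE.le.eventuallyLE hsub) with h | h
  · exact absurd (measure_congr h) (by simpa using hpos.ne')
  · filter_upwards [eventuallyEq_univ.1 h] with x hx using Set.mem_iUnion.1 hx

lemma ae_exists_shiftIter_mem_left [IsProbabilityMeasure μ] (herg : Ergodic (shiftMap A) μ)
    {E : Set (ℤ → A)} (hE : IsOpen E) (hμE : 0 < μ E) (p : ℕ) :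
    ∀ᵐ x ∂μ, ∃ m : ℕ, shiftIter (-(m : ℤ) + -(p : ℤ)) x ∈ E := by
  set G : Set (ℤ → A) := ⋃ m : ℕ, shiftIter (-(m : ℤ) + -(p : ℤ)) ⁻¹' E with hG
  have hGo : IsOpen G := isOpen_iUnion fun m => hE.preimage (continuous_shiftIter _)
  have hsub : G ⊆ shiftMap A ⁻¹' G := by
    intro x hx
    simp only [hG, Set.mem_preimage, Set.mem_iUnion, shiftIter_shiftMap] at hx ⊢
    obtain ⟨m, hm⟩ := hx
    refine ⟨m + 1, ?_⟩
    convert hm using 2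
    push_cast
    ring
  have hpos : 0 < μ G := by
    rw [← (herg.toMeasurePreserving.iterate p).measure_preimage
      hGo.measurableSet.nullMeasurableSet]
    refine hμE.trans_le (measure_mono fun x hx => ?_)
    rw [Set.mem_preimage, shiftMap_iterate]
    refine Set.mem_iUnion.2 ⟨0, ?_⟩
    rw [Set.mem_preimage, shiftIter_shiftIter]
    simpa [shiftIter_zero] using hx
  rcases herg.ae_empty_or_univ_of_ae_le_preimage hGo.measurableSet.nullMeasurableSet
    (LE.le.eventuallyLE hsub) with h | h
  · exact absurd (measure_congr h) (by simpa using hpos.ne')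
  · filter_upwards [eventuallyEq_univ.1 h] with x hx using Set.mem_iUnion.1 hx

end Recurrence

/-- If `F` has an equicontinuous point in `S(μ)`, then for every `p ≥ r` and a.e.
`x` the sequence `(Iₙ⁺(σ^{-p}x) + Iₙ⁻(σ^{p}x))ₙ` is bounded. -/
theorem stmt7 {A : Type*} [Fintype A] [TopologicalSpace A] [DiscreteTopology A]
    [MeasurableSpace A] [BorelSpace A]
    (X : Set (ℤ → A)) (hXcl : IsClosed X) (hXσ : shiftMap A '' X = X)
    (F : (ℤ → A) → (ℤ → A)) (hFX : Set.MapsTo F X X) (hFc : Continuous F)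
    (hFσ : ∀ x, F (shiftMap A x) = shiftMap A (F x))
    (r : ℕ) (hr : 1 ≤ r) (hloc : HasLocalRule F r)
    (μ : Measure (ℤ → A)) [IsProbabilityMeasure μ]
    (herg : Ergodic (shiftMap A) μ) (hsuppX : msupp μ ⊆ X)
    (hec : ∃ x ∈ msupp μ, IsEquicontPt X F x) :
    ∀ p : ℕ, r ≤ p → ∀ᵐ x ∂μ, ∃ C : ℕ, ∀ n : ℕ,
      Iplus X F n (shiftIter (-(p : ℤ)) x) + Iminus X F n (shiftIter (p : ℤ) x) ≤ C := by
  intro p _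
  obtain ⟨x₀, hx₀, heq⟩ := hec
  obtain ⟨k, hk⟩ := heq r
  have hopen := isOpen_centralCylinder k x₀
  have hpos := hx₀ _ hopen fun _ _ => rfl
  filter_upwards [ae_mem_of_msupp_subset hsuppX,
    ae_exists_shiftIter_mem_left herg hopen hpos p,
    ae_exists_shiftIter_mem_right herg hopen hpos p] with x hx ⟨a, ha⟩ ⟨b, hb⟩
  rw [← shiftIter_shiftIter] at ha hb
  exact ⟨(a + k + r) + (b + k + r), fun n => add_le_add
    (Iplus_le_of_mem_centralCylinder hXσ hFX hloc hk (shiftIter_mem hXσ _ hx) ha n)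
    (Iminus_le_of_mem_centralCylinder hXσ hFX hloc hk (shiftIter_mem hXσ _ hx) hb n)⟩
end
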